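/- arXiv:2307.11747 — 5 statements merged into one kernel-verified Lean document; each statement's English description precedes it below -/
import Mathlib

section
/- For every real K > 0 and every real x, |relu(x) − x·(1 + tanh(K·x))/2| ≤ |x|·exp(−2·K·|x|). -/
/-- The relu function. -/
noncomputable def relu (x : ℝ) : ℝ := max 0 x

theorem one_sub_tanh_div_two_le_exp (y : ℝ) :
    (1 - Real.tanh y) / 2 ≤ Real.exp (-2 * y) := by
  have h : (1 - Real.tanh y) / 2 = Real.exp (-y) / (Real.exp y + Real.exp (-y)) := by
    have : Real.exp y + Real.exp (-y) ≠ 0 := by positivity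
    rw [Real.tanh_eq]
    field_simp
    ring
  rw [h, show -2 * y = -y - y by ring, Real.exp_sub]
  gcongr
  exact le_add_of_nonneg_right (Real.exp_pos _).le

theorem relu_sub_mul_one_add_tanh (K x : ℝ) :
    relu x - x * (1 + Real.tanh (K * x)) / 2 = |x| * ((1 - Real.tanh (K * |x|)) / 2) := by
  rcases le_total 0 x with hx | hx
  · rw [relu, max_eq_right hx, abs_of_nonneg hx]
    ring
  · rw [relu, max_eq_left hx, abs_of_nonpos hx, mul_neg, Real.tanh_neg]
    ring

theorem relu_tanh_approx (K x : ℝ) (hK : 0 < K) :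
    |relu x - x * (1 + Real.tanh (K * x)) / 2| ≤ |x| * Real.exp (-2 * K * |x|) := by
  have h_nonneg : 0 ≤ (1 - Real.tanh (K * |x|)) / 2 := by
    linarith [Real.tanh_lt_one (K * |x|)]
  rw [relu_sub_mul_one_add_tanh, abs_of_nonneg (mul_nonneg (abs_nonneg x) h_nonneg), mul_assoc (-2)]
  exact mul_le_mul_of_nonneg_left (one_sub_tanh_div_two_le_exp _) (abs_nonneg x)
end

section
/- Let a < b be reals and let m, c be natural numbers with 1/(b − a) ≤ 2^c. Define S(x) = ((x − a)·(1 + tanh(2^{m+c+3}·(x − a))) − (x − b)·(1 + tanh(2^{m+c+3}·(x − b))))/(2·(b − a)). Then for every real x, |S(x) − sig(a, b, x)| ≤ 2^{−m}. (Uniform approximation of the piecewise affine sigmoid by an analytic tanh-expression.) -/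
/-- The piecewise affine sigmoid: 0 for x ≤ a, (x-a)/(b-a) for a ≤ x ≤ b, 1 for x ≥ b. -/
noncomputable def sig (a b x : ℝ) : ℝ :=
  if x ≤ a then 0 else if x ≤ b then (x - a) / (b - a) else 1

theorem mul_tanh_le_abs (y : ℝ) : y * Real.tanh y ≤ |y| :=
  calc y * Real.tanh y ≤ |y * Real.tanh y| := le_abs_self _
    _ = |y| * |Real.tanh y| := abs_mul _ _
    _ ≤ |y| := mul_le_of_le_one_right (abs_nonneg y) (Real.abs_tanh_lt_one y).le

theorem sub_one_le_mul_tanh_of_nonneg {y : ℝ} (hy : 0 ≤ y) : y - 1 ≤ y * Real.tanh y := by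
  have hE := Real.add_one_le_exp y
  have hE' := Real.exp_pos (-y)
  have hmul : Real.exp y * Real.exp (-y) = 1 := by rw [← Real.exp_add]; simp
  have hsq : 2 * y ≤ Real.exp y ^ 2 + 1 := by nlinarith
  have key : 2 * y * Real.exp (-y) ≤ Real.exp y + Real.exp (-y) := by
    calc 2 * y * Real.exp (-y) ≤ (Real.exp y ^ 2 + 1) * Real.exp (-y) := by gcongr
      _ = Real.exp y * (Real.exp y * Real.exp (-y)) + Real.exp (-y) := by ring
      _ = Real.exp y + Real.exp (-y) := by rw [hmul, mul_one]
  rw [Real.tanh_eq, ← mul_div_assoc, le_div_iff₀ (by positivity)]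
  linarith

theorem abs_sub_one_le_mul_tanh (y : ℝ) : |y| - 1 ≤ y * Real.tanh y := by
  rcases le_total 0 y with hy | hy
  · simpa [abs_of_nonneg hy] using sub_one_le_mul_tanh_of_nonneg hy
  · simpa [abs_of_nonpos hy] using sub_one_le_mul_tanh_of_nonneg (neg_nonneg.2 hy)

theorem abs_sub_mul_tanh_mul_mem_Icc {K : ℝ} (hK : 0 < K) (t : ℝ) :
    |t| - t * Real.tanh (K * t) ∈ Set.Icc 0 (1 / K) := by
  have h₁ := mul_tanh_le_abs (K * t)
  have h₂ := abs_sub_one_le_mul_tanh (K * t)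
  rw [abs_mul, abs_of_pos hK] at h₁ h₂
  constructor
  · have : 0 ≤ K * (|t| - t * Real.tanh (K * t)) := by linarith
    exact nonneg_of_mul_nonneg_right this hK
  · rw [le_div_iff₀ hK]
    linarith

theorem sig_eq_abs_sub_abs {a b : ℝ} (hab : a < b) (x : ℝ) :
    sig a b x = ((x - a + |x - a|) - (x - b + |x - b|)) / (2 * (b - a)) := by
  have hd : b - a ≠ 0 := (sub_pos.2 hab).ne'
  unfold sig
  split_ifs with h₁ h₂
  · rw [abs_of_nonpos (by linarith), abs_of_nonpos (by linarith)]
    simp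
  · rw [abs_of_nonneg (by linarith), abs_of_nonpos (by linarith)]
    field_simp
    ring
  · rw [abs_of_nonneg (by linarith), abs_of_nonneg (by linarith)]
    field_simp
    ring

theorem sig_tanh_uniform_approx (a b : ℝ) (m c : ℕ) (hab : a < b)
    (hc : 1 / (b - a) ≤ (2 : ℝ) ^ c) (x : ℝ) :
    |((x - a) * (1 + Real.tanh ((2 : ℝ) ^ (m + c + 3) * (x - a)))
        - (x - b) * (1 + Real.tanh ((2 : ℝ) ^ (m + c + 3) * (x - b)))) / (2 * (b - a))
      - sig a b x| ≤ (2 : ℝ) ^ (-(m : ℤ)) := by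
  have hd : 0 < b - a := sub_pos.2 hab
  have hK : (0 : ℝ) < 2 ^ (m + c + 3) := by positivity
  obtain ⟨ha₀, ha₁⟩ := abs_sub_mul_tanh_mul_mem_Icc hK (x - a)
  obtain ⟨hb₀, hb₁⟩ := abs_sub_mul_tanh_mul_mem_Icc hK (x - b)
  have hbound : 1 / (2 : ℝ) ^ (m + c + 3) ≤ (2 : ℝ) ^ (-(m : ℤ)) * (2 * (b - a)) := by
    rw [div_le_iff₀ hd] at hc
    rw [zpow_neg, zpow_natCast, div_le_iff₀ hK]
    have : ((2 : ℝ) ^ m)⁻¹ * (2 * (b - a)) * 2 ^ (m + c + 3) = 16 * (2 ^ c * (b - a)) := by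
      rw [pow_add, pow_add]
      field_simp
      ring
    linarith
  rw [sig_eq_abs_sub_abs hab, ← sub_div, abs_div, abs_of_pos (by positivity : 0 < 2 * (b - a)),
    div_le_iff₀ (by positivity), abs_le]
  constructor <;> linarith
end

section
/- Let n ≥ 1, let α₁ < α₂ < ⋯ < αₙ be integers and V₁, …, Vₙ be reals. Define f : ℝ → ℝ by f(x) = V₁ + Σ_{j=1}^{n−1} sig(1/4, 3/4, x − α_j)·(V_{j+1} − V_j). Then for every index i ∈ {1, …, n} and every real x with α_i − 1/4 ≤ x ≤ α_i + 1/4, one has f(x) = V_i. -/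
theorem sig_eq_zero {a b x : ℝ} (hx : x ≤ a) : sig a b x = 0 :=
  if_pos hx

theorem sig_eq_one {a b x : ℝ} (hab : a < b) (hx : b ≤ x) : sig a b x = 1 := by
  unfold sig
  rw [if_neg (hab.trans_le hx).not_ge]
  split_ifs with hxb
  · rw [le_antisymm hxb hx, div_self (sub_pos.2 hab).ne']
  · rfl

theorem lt_of_lt_succ_of_lt_bound {β : Type*} [Preorder β] {n : ℕ} {α : ℕ → β}
    (hα : ∀ i, i + 1 < n → α i < α (i + 1)) {j k : ℕ} (hjk : j < k) (hk : k < n) :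
    α j < α k := by
  induction k, hjk using Nat.le_induction with
  | base => exact hα j hk
  | succ k _ ih => exact (ih (Nat.lt_of_succ_lt hk)).trans (hα k hk)

theorem send_exact (n : ℕ) (hn : 1 ≤ n) (α : ℕ → ℤ) (V : ℕ → ℝ)
    (hα : ∀ i, i + 1 < n → α i < α (i + 1))
    (f : ℝ → ℝ)
    (hf : ∀ x, f x = V 0 + ∑ j ∈ Finset.range (n - 1),
      sig (1/4) (3/4) (x - α j) * (V (j + 1) - V j))
    (i : ℕ) (hi : i < n) (x : ℝ)
    (hx₁ : (α i : ℝ) - 1/4 ≤ x) (hx₂ : x ≤ (α i : ℝ) + 1/4) :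
    f x = V i := by
  have hsum : ∑ j ∈ Finset.range (n - 1), sig (1/4) (3/4) (x - α j) * (V (j + 1) - V j)
      = ∑ j ∈ Finset.range i, (V (j + 1) - V j) := by
    symm
    refine Finset.sum_subset_zero_on_sdiff
      (Finset.range_subset_range.2 (Nat.le_sub_one_of_lt hi)) ?_ ?_
    · intro j hj
      simp only [Finset.mem_sdiff, Finset.mem_range, not_lt] at hj
      have hle : α i ≤ α j := by
        rcases hj.2.eq_or_lt with rfl | hij
        · exact le_rfl
        · exact (lt_of_lt_succ_of_lt_bound hα hij (by omega)).le
      have hle' : (α i : ℝ) ≤ α j := by exact_mod_cast hle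
      rw [sig_eq_zero (by linarith), zero_mul]
    · intro j hj
      have hlt : α j + 1 ≤ α i := lt_of_lt_succ_of_lt_bound hα (Finset.mem_range.1 hj) hi
      have hlt' : (α j : ℝ) + 1 ≤ α i := by exact_mod_cast hlt
      rw [sig_eq_one (by norm_num) (by linarith), one_mul]
  rw [hf, hsum, Finset.sum_range_sub, add_sub_cancel]
end

section
/- Let n ≥ 1, let α₁ < α₂ < ⋯ < αₙ be integers, V₁, …, Vₙ be reals, and m, c be natural numbers with Σ_{j=1}^{n−1} |V_{j+1} − V_j| ≤ 2^c. Let S : ℝ → ℝ be any function such that |S(y) − sig(1/4, 3/4, y)| ≤ 2^{−(m+c)} for all real y. Define g(x) = V₁ + Σ_{j=1}^{n−1} S(x − α_j)·(V_{j+1} − V_j). Then for every index i ∈ {1, …, n} and every real x with α_i − 1/4 ≤ x ≤ α_i + 1/4, one has |g(x) − V_i| ≤ 2^{−m}. -/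
theorem sig_of_le {a b x : ℝ} (h : x ≤ a) : sig a b x = 0 := if_pos h

theorem sig_of_ge {a b x : ℝ} (hab : a < b) (h : b ≤ x) : sig a b x = 1 := by
  unfold sig
  rw [if_neg (by linarith)]
  split_ifs with hx
  · obtain rfl : x = b := le_antisymm hx h
    exact div_self (by linarith)
  · rfl

/-- An integer sequence strictly increasing below `n` grows by at least one per step there. -/
theorem int_add_sub_le_of_lt_succ {n : ℕ} {α : ℕ → ℤ}
    (hα : ∀ i, i + 1 < n → α i < α (i + 1)) {i j : ℕ} (hij : i ≤ j) (hj : j < n) :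
    α i + ((j : ℤ) - i) ≤ α j := by
  induction j, hij using Nat.le_induction with
  | base => simp
  | succ k hk ih =>
    have h₁ := ih (by omega)
    have h₂ := hα k hj
    push_cast
    omega

/-- At a point within `1/4` of `α i`, the steps located at the `α j` switch on exactly the
increments of `V` before index `i`. -/
theorem sum_sig_mul_sub {n : ℕ} {α : ℕ → ℤ} (V : ℕ → ℝ)
    (hα : ∀ i, i + 1 < n → α i < α (i + 1)) {i : ℕ} (hi : i < n) {x : ℝ}
    (hx₁ : (α i : ℝ) - 1/4 ≤ x) (hx₂ : x ≤ (α i : ℝ) + 1/4) :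
    ∑ j ∈ Finset.range (n - 1), sig (1/4) (3/4) (x - α j) * (V (j + 1) - V j) = V i - V 0 := by
  rw [← Finset.sum_range_sub V i]
  symm
  have hsub : Finset.range i ⊆ Finset.range (n - 1) := Finset.range_mono (by omega)
  rw [← Finset.sum_subset hsub]
  · refine Finset.sum_congr rfl fun j hj => ?_
    have hji := Finset.mem_range.mp hj
    have h := int_add_sub_le_of_lt_succ hα hji.le hi
    have h' : α j + 1 ≤ α i := by omega
    have h'' : (α j : ℝ) + 1 ≤ α i := by exact_mod_cast h'
    rw [sig_of_ge (by norm_num) (by linarith), one_mul]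
  · intro j hj hji
    rw [Finset.mem_range] at hj hji
    have h := int_add_sub_le_of_lt_succ hα (not_lt.mp hji) (show j < n by omega)
    have h' : α i ≤ α j := by omega
    have h'' : (α i : ℝ) ≤ α j := by exact_mod_cast h'
    rw [sig_of_le (by linarith), zero_mul]

theorem send_approx (n : ℕ) (hn : 1 ≤ n) (α : ℕ → ℤ) (V : ℕ → ℝ) (m c : ℕ)
    (hα : ∀ i, i + 1 < n → α i < α (i + 1))
    (hV : ∑ j ∈ Finset.range (n - 1), |V (j + 1) - V j| ≤ (2 : ℝ) ^ c)
    (S : ℝ → ℝ)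
    (hS : ∀ y, |S y - sig (1/4) (3/4) y| ≤ (2 : ℝ) ^ (-((m + c : ℕ) : ℤ)))
    (g : ℝ → ℝ)
    (hg : ∀ x, g x = V 0 + ∑ j ∈ Finset.range (n - 1),
      S (x - α j) * (V (j + 1) - V j))
    (i : ℕ) (hi : i < n) (x : ℝ)
    (hx₁ : (α i : ℝ) - 1/4 ≤ x) (hx₂ : x ≤ (α i : ℝ) + 1/4) :
    |g x - V i| ≤ (2 : ℝ) ^ (-(m : ℤ)) := by
  have key := sum_sig_mul_sub V hα hi hx₁ hx₂
  have hdiff : g x - V i = ∑ j ∈ Finset.range (n - 1),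
      (S (x - α j) - sig (1/4) (3/4) (x - α j)) * (V (j + 1) - V j) := by
    simp only [sub_mul _ _ (V _ - V _), Finset.sum_sub_distrib]
    rw [key, hg]
    ring
  rw [hdiff]
  calc |∑ j ∈ Finset.range (n - 1),
        (S (x - α j) - sig (1/4) (3/4) (x - α j)) * (V (j + 1) - V j)|
      ≤ ∑ j ∈ Finset.range (n - 1),
        |(S (x - α j) - sig (1/4) (3/4) (x - α j)) * (V (j + 1) - V j)| :=
        Finset.abs_sum_le_sum_abs _ _
    _ ≤ ∑ j ∈ Finset.range (n - 1),
        (2 : ℝ) ^ (-((m + c : ℕ) : ℤ)) * |V (j + 1) - V j| := by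
        refine Finset.sum_le_sum fun j _ => ?_
        rw [abs_mul]
        exact mul_le_mul_of_nonneg_right (hS _) (abs_nonneg _)
    _ = (2 : ℝ) ^ (-((m + c : ℕ) : ℤ)) * ∑ j ∈ Finset.range (n - 1), |V (j + 1) - V j| := by
        rw [Finset.mul_sum]
    _ ≤ (2 : ℝ) ^ (-((m + c : ℕ) : ℤ)) * (2 : ℝ) ^ c := by gcongr
    _ = (2 : ℝ) ^ (-(m : ℤ)) := by
        rw [← zpow_natCast (2 : ℝ) c, ← zpow_add₀ (two_ne_zero)]
        push_cast
        congr 1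
        ring
end

section
/- Let ℓ(x) denote the binary length of the natural number x (the number of digits of x in base 2, with ℓ(0) = 0). Let d ∈ ℕ, let h : (Fin d → ℝ) → ℕ → (Fin d → ℝ), and let f : ℕ → (Fin d → ℝ) satisfy, for all x ≥ 1, f(x+1) = f(x) + (ℓ(x+1) − ℓ(x)) • h(f(x), x). Define F : ℕ → (Fin d → ℝ) by F(1) = f(1) and F(t+1) = F(t) + h(F(t), 2^t − 1) for all t ≥ 1. Then for every x ≥ 1, f(x) = F(ℓ(x)). (A function defined by a length-ODE depends only on the length of its argument, and satisfies the corresponding recurrence along powers of 2.) -/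
/-- The binary length is unchanged by a successor that stays below the next power of two. -/
theorem Nat.size_succ_of_lt_two_pow_size {n : ℕ} (hn : n + 1 < 2 ^ n.size) :
    (n + 1).size = n.size :=
  le_antisymm (Nat.size_le.2 hn) (Nat.size_le_size n.le_succ)

/-- A successor either preserves the binary length or reaches the next power of two. -/
theorem Nat.size_succ_eq_or (n : ℕ) :
    (n + 1).size = n.size ∨ (n + 1).size = n.size + 1 ∧ n = 2 ^ n.size - 1 := by
  rcases (Nat.succ_le_of_lt n.lt_size_self).lt_or_eq with hlt | heq
  · exact Or.inl (Nat.size_succ_of_lt_two_pow_size hlt)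
  · have heq' : n + 1 = 2 ^ n.size := heq
    exact Or.inr ⟨by rw [heq', Nat.size_pow], by omega⟩


theorem length_ode_change_of_variable (d : ℕ)
    (h : (Fin d → ℝ) → ℕ → (Fin d → ℝ))
    (f : ℕ → (Fin d → ℝ))
    (hf : ∀ x : ℕ, 1 ≤ x →
      f (x + 1) = f x + ((Nat.size (x + 1) - Nat.size x : ℕ) : ℝ) • h (f x) x)
    (F : ℕ → (Fin d → ℝ))
    (hF1 : F 1 = f 1)
    (hF : ∀ t : ℕ, 1 ≤ t → F (t + 1) = F t + h (F t) (2 ^ t - 1))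
    (x : ℕ) (hx : 1 ≤ x) :
    f x = F (Nat.size x) := by
  induction x, hx using Nat.le_induction with
  | base => rw [Nat.size_one, hF1]
  | succ n hn ih =>
    rw [hf n hn]
    rcases n.size_succ_eq_or with hsize | ⟨hsize, hpow⟩
    · rw [hsize, Nat.sub_self, Nat.cast_zero, zero_smul, add_zero, ih]
    · rw [hsize, Nat.add_sub_cancel_left, Nat.cast_one, one_smul, hF _ (Nat.size_pos.2 hn),
        ← hpow, ih]
end
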